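/- Fix q ∈ ℝ with 0 < q < 1/2 and let a(Δ) := (Q(q)^Δ)_{1,0}. Define N(H) := a(H) − H·(a(H) − a(H−1)) for integers H ≥ 1. Then N(1) = 0, N(H+1) − N(H) = 2Hq²(1−2q)^{H−1} > 0 for every H ≥ 1, hence N is strictly increasing over integers H ≥ 1, N(H) ≥ 0 for all H ≥ 1, and N(H) > 0 for all H ≥ 2. -/

import Mathlib

open Matrix

/-- The one-step transition matrix of a symmetric two-state Markov chain
with switching probability `q`. -/
def Qmat (q : ℝ) : Matrix (Fin 2) (Fin 2) ℝ := !![1 - q, q; q, 1 - q]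

/-- `a q Δ` is the `(1,0)` entry of the `Δ`-th power of `Qmat q`. -/
def a (q : ℝ) (Δ : ℕ) : ℝ := (Qmat q ^ Δ) 1 0

/-- Numerator of the Whittle index in state `(X̂ = 1, AoI = H)`. -/
def Nnum (q : ℝ) (H : ℕ) : ℝ := a q H - H * (a q H - a q (H - 1))

theorem Qmat_pow (q : ℝ) (n : ℕ) :
    Qmat q ^ n = !![(1 + (1 - 2*q)^n) / 2, (1 - (1 - 2*q)^n) / 2;
      (1 - (1 - 2*q)^n) / 2, (1 + (1 - 2*q)^n) / 2] := by
  induction n with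
  | zero => ext i j; fin_cases i <;> fin_cases j <;> norm_num
  | succ n ih =>
    rw [pow_succ, ih, Qmat]
    ext i j
    fin_cases i <;> fin_cases j <;> simp [Matrix.mul_apply, Fin.sum_univ_two] <;> ring

theorem a_eq (q : ℝ) (n : ℕ) : a q n = (1 - (1 - 2*q)^n) / 2 := by
  simp [a, Qmat_pow]

theorem Nnum_one (q : ℝ) : Nnum q 1 = 0 := by
  simp [Nnum, a_eq]

theorem Nnum_succ_sub (q : ℝ) {H : ℕ} (hH : 1 ≤ H) :
    Nnum q (H + 1) - Nnum q H = 2 * H * q^2 * (1 - 2*q)^(H - 1) := by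
  obtain ⟨n, rfl⟩ := Nat.exists_eq_add_of_le' hH
  simp only [Nnum, a_eq, Nat.add_sub_cancel]
  push_cast
  ring

theorem stmt_9 (q : ℝ) (hq0 : 0 < q) (hq1 : q < 1/2) :
    Nnum q 1 = 0 ∧
    (∀ H : ℕ, 1 ≤ H →
      Nnum q (H + 1) - Nnum q H = 2 * H * q^2 * (1 - 2*q)^(H - 1) ∧
      0 < 2 * (H : ℝ) * q^2 * (1 - 2*q)^(H - 1)) ∧
    (∀ H₁ H₂ : ℕ, 1 ≤ H₁ → H₁ < H₂ → Nnum q H₁ < Nnum q H₂) ∧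
    (∀ H : ℕ, 1 ≤ H → 0 ≤ Nnum q H) ∧
    (∀ H : ℕ, 2 ≤ H → 0 < Nnum q H) := by
  have hpos : ∀ H : ℕ, 1 ≤ H → 0 < 2 * (H : ℝ) * q^2 * (1 - 2*q)^(H - 1) := by
    intro H hH
    have hr : 0 < 1 - 2*q := by linarith
    have hH' : (0 : ℝ) < H := by exact_mod_cast hH
    positivity
  have hmono : ∀ H₁ H₂ : ℕ, 1 ≤ H₁ → H₁ < H₂ → Nnum q H₁ < Nnum q H₂ := by
    intro H₁ H₂ h₁ hlt
    induction H₂, hlt using Nat.le_induction with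
    | base => linarith [Nnum_succ_sub q h₁, hpos H₁ h₁]
    | succ n hn ih =>
      have hn' : 1 ≤ n := by omega
      linarith [Nnum_succ_sub q hn', hpos n hn']
  have hpos_two : ∀ H : ℕ, 2 ≤ H → 0 < Nnum q H := fun H hH =>
    Nnum_one q ▸ hmono 1 H le_rfl hH
  refine ⟨Nnum_one q, fun H hH => ⟨Nnum_succ_sub q hH, hpos H hH⟩, hmono, fun H hH => ?_,
    hpos_two⟩
  rcases hH.eq_or_lt with rfl | h
  · exact (Nnum_one q).ge
  · exact (hpos_two H h).le
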